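/- arXiv:2007.12960 — 6 statements merged into one kernel-verified Lean document; each statement's English description precedes it below -/
import Mathlib

section
/- For every T > 0 there exists a constant C = C(T) > 0 such that for all x, y ∈ (0,1) and all 0 < t ≤ T, one has G_t(x,y)² ≤ C t^{-1/2} G_{t/2}(x,y). -/
open MeasureTheory Real Filter

/-- The Neumann heat Green function on `[0,1]`. -/
noncomputable def G (t x y : ℝ) : ℝ :=
  (1 / Real.sqrt (4 * Real.pi * t)) *
    ∑' n : ℤ, (Real.exp (-(x - y - 2 * (n : ℝ)) ^ 2 / (4 * t)) +
      Real.exp (-(x + y - 2 * (n : ℝ)) ^ 2 / (4 * t)))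

/-- The `n`-th term of the periodised Gaussian decays, relative to the term at the nearest
lattice point, uniformly in `t ≤ T`. -/
lemma exp_neg_sq_sub_le {T t w : ℝ} (ht : 0 < t) (htT : t ≤ T) (hw : |w| ≤ 1) (n : ℤ) :
    exp (-(w - 2 * (n : ℝ)) ^ 2 / (4 * t)) ≤
      exp (-w ^ 2 / (4 * t)) * exp (-((n : ℝ) ^ 2 - |(n : ℝ)|) / T) := by
  have hT : 0 < T := ht.trans_le htT
  have hn : 0 ≤ (n : ℝ) ^ 2 - |(n : ℝ)| := by
    have h : |n| ≤ n ^ 2 := by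
      rw [← sq_abs]
      exact Int.le_self_sq _
    have h' : |(n : ℝ)| ≤ (n : ℝ) ^ 2 := by exact_mod_cast h
    linarith
  have hwn : w * n ≤ |(n : ℝ)| := by
    calc w * n ≤ |w * n| := le_abs_self _
      _ = |w| * |(n : ℝ)| := abs_mul _ _
      _ ≤ 1 * |(n : ℝ)| := by gcongr
      _ = |(n : ℝ)| := one_mul _
  rw [← exp_add, exp_le_exp]
  have h1 : ((n : ℝ) ^ 2 - |(n : ℝ)|) / T ≤ ((n : ℝ) ^ 2 - |(n : ℝ)|) / t := by gcongr
  have h2 : -(w - 2 * (n : ℝ)) ^ 2 / (4 * t) ≤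
      -w ^ 2 / (4 * t) - ((n : ℝ) ^ 2 - |(n : ℝ)|) / t := by
    rw [show -w ^ 2 / (4 * t) - ((n : ℝ) ^ 2 - |(n : ℝ)|) / t =
      (-w ^ 2 - 4 * ((n : ℝ) ^ 2 - |(n : ℝ)|)) / (4 * t) by field_simp]
    gcongr
    nlinarith
  rw [neg_div T]
  linarith

lemma summable_exp_neg_sq_sub_abs {T : ℝ} (hT : 0 < T) :
    Summable fun n : ℤ => exp (-((n : ℝ) ^ 2 - |(n : ℝ)|) / T) := by
  have hnat : Summable fun n : ℕ => exp (1 / T) * exp (n * (-(1 / T))) :=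
    (Real.summable_exp_nat_mul_iff.2 (by simpa using hT)).mul_left _
  have key (n : ℕ) : exp (-((n : ℝ) ^ 2 - n) / T) ≤ exp (1 / T) * exp (n * (-(1 / T))) := by
    rw [← exp_add, exp_le_exp,
      show 1 / T + (n : ℝ) * (-(1 / T)) = (1 - n) / T by ring]
    gcongr
    nlinarith [sq_nonneg ((n : ℝ) - 1)]
  have hs := Summable.of_nonneg_of_le (fun n => (exp_pos _).le) key hnat
  exact Summable.of_nat_of_neg (by simpa using hs) (by simpa using hs)

/-- The periodised Gaussian is summable, and its sum is controlled by its largest term. -/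
lemma summable_and_tsum_exp_le {T t : ℝ} (ht : 0 < t) (htT : t ≤ T) (z : ℝ) :
    Summable (fun n : ℤ => exp (-(z - 2 * (n : ℝ)) ^ 2 / (4 * t))) ∧
      ∑' n : ℤ, exp (-(z - 2 * (n : ℝ)) ^ 2 / (4 * t)) ≤
        exp (-(z - 2 * (round (z / 2) : ℝ)) ^ 2 / (4 * t)) *
          ∑' n : ℤ, exp (-((n : ℝ) ^ 2 - |(n : ℝ)|) / T) := by
  set k : ℤ := round (z / 2)
  have hw : |z - 2 * (k : ℝ)| ≤ 1 := by
    have h : |z / 2 - k| ≤ 1 / 2 := abs_sub_round (z / 2)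
    rw [abs_le] at h ⊢
    constructor <;> linarith [h.1, h.2]
  have hle (n : ℤ) : exp (-(z - 2 * ((Equiv.addRight k n : ℤ) : ℝ)) ^ 2 / (4 * t)) ≤
      exp (-(z - 2 * (k : ℝ)) ^ 2 / (4 * t)) * exp (-((n : ℝ) ^ 2 - |(n : ℝ)|) / T) := by
    have h := exp_neg_sq_sub_le ht htT hw n
    rwa [show z - 2 * (k : ℝ) - 2 * n = z - 2 * ((Equiv.addRight k n : ℤ) : ℝ) by
      simp only [Equiv.coe_addRight]; push_cast; ring] at h
  have hK := (summable_exp_neg_sq_sub_abs (ht.trans_le htT)).mul_left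
    (exp (-(z - 2 * (k : ℝ)) ^ 2 / (4 * t)))
  have hs := Summable.of_nonneg_of_le (fun n => (exp_pos _).le) hle hK
  refine ⟨(Equiv.addRight k).summable_iff.1 hs, ?_⟩
  rw [← (Equiv.addRight k).tsum_eq, ← tsum_mul_left]
  exact hs.tsum_le_tsum hle hK

lemma summable_exp_neg_sq {t : ℝ} (ht : 0 < t) (z : ℝ) :
    Summable fun n : ℤ => exp (-(z - 2 * (n : ℝ)) ^ 2 / (4 * t)) :=
  (summable_and_tsum_exp_le ht le_rfl z).1

/-- The square of the periodised Gaussian is controlled by the periodised Gaussian at half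
the time. -/
lemma sq_tsum_exp_neg_sq_le {T t : ℝ} (ht : 0 < t) (htT : t ≤ T) (z : ℝ) :
    (∑' n : ℤ, exp (-(z - 2 * (n : ℝ)) ^ 2 / (4 * t))) ^ 2 ≤
      (∑' n : ℤ, exp (-((n : ℝ) ^ 2 - |(n : ℝ)|) / T)) ^ 2 *
        ∑' n : ℤ, exp (-(z - 2 * (n : ℝ)) ^ 2 / (4 * (t / 2))) := by
  have h0 : 0 ≤ ∑' n : ℤ, exp (-(z - 2 * (n : ℝ)) ^ 2 / (4 * t)) :=
    tsum_nonneg fun n => (exp_pos _).le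
  have h := pow_le_pow_left₀ h0 (summable_and_tsum_exp_le ht htT z).2 2
  refine h.trans ?_
  rw [mul_pow, mul_comm]
  gcongr
  rw [← exp_nat_mul]
  convert (summable_exp_neg_sq (half_pos ht) z).le_tsum (round (z / 2))
    (fun n _ => (exp_pos _).le) using 2
  push_cast
  field_simp

/-- For every `T > 0` there is `C = C(T) > 0` such that
`G_t(x,y)² ≤ C t^{-1/2} G_{t/2}(x,y)` for all `x, y ∈ (0,1)` and `0 < t ≤ T`. -/
theorem green_sq_bound (T : ℝ) (hT : 0 < T) :
    ∃ C : ℝ, 0 < C ∧ ∀ x ∈ Set.Ioo (0:ℝ) 1, ∀ y ∈ Set.Ioo (0:ℝ) 1, ∀ t : ℝ, 0 < t → t ≤ T →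
      (G t x y) ^ 2 ≤ C / Real.sqrt t * G (t / 2) x y := by
  set K : ℝ := ∑' n : ℤ, exp (-((n : ℝ) ^ 2 - |(n : ℝ)|) / T) with hKdef
  have hK : 0 < K :=
    (summable_exp_neg_sq_sub_abs hT).tsum_pos (fun n => (exp_pos _).le) 0 (exp_pos _)
  refine ⟨K ^ 2 * √(2 * π) / (2 * π), by positivity, fun x _ y _ t ht htT => ?_⟩
  unfold G
  rw [(summable_exp_neg_sq ht (x - y)).tsum_add (summable_exp_neg_sq ht (x + y)),
    (summable_exp_neg_sq (half_pos ht) (x - y)).tsum_add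
      (summable_exp_neg_sq (half_pos ht) (x + y))]
  have h1 := sq_tsum_exp_neg_sq_le ht htT (x - y)
  have h2 := sq_tsum_exp_neg_sq_le ht htT (x + y)
  rw [← hKdef] at h1 h2
  set a := ∑' n : ℤ, exp (-(x - y - 2 * (n : ℝ)) ^ 2 / (4 * t))
  set b := ∑' n : ℤ, exp (-(x + y - 2 * (n : ℝ)) ^ 2 / (4 * t))
  set c := ∑' n : ℤ, exp (-(x - y - 2 * (n : ℝ)) ^ 2 / (4 * (t / 2)))
  set d := ∑' n : ℤ, exp (-(x + y - 2 * (n : ℝ)) ^ 2 / (4 * (t / 2)))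
  have hrhs : K ^ 2 * √(2 * π) / (2 * π) / √t * (1 / √(4 * π * (t / 2)) * (c + d)) =
      1 / (4 * π * t) * (2 * (K ^ 2 * (c + d))) := by
    rw [show 4 * π * (t / 2) = 2 * π * t by ring, sqrt_mul (by positivity) t]
    have hs : √t ^ 2 = t := sq_sqrt ht.le
    have hs0 : √t ≠ 0 := (sqrt_pos.2 ht).ne'
    have hp0 : √(2 * π) ≠ 0 := (sqrt_pos.2 (by positivity)).ne'
    rw [← hs, sqrt_sq (sqrt_nonneg t)]
    field_simp
    ring
  rw [hrhs, mul_pow, div_pow, one_pow, sq_sqrt (by positivity)]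
  gcongr
  nlinarith [sq_nonneg (a - b)]
end

section
/- For every T > 0 there exists a constant C = C(T) > 0 such that for all x, y ∈ (0,1) and all 0 < s < t ≤ T, one has G_s(x,y) ≤ C √(t/s) G_t(x,y). -/
open MeasureTheory Real Filter

/-- Lattice sums of Gaussians converge. -/
theorem summable_exp_neg_sub_two_mul_int_sq {t : ℝ} (ht : 0 < t) (a : ℝ) :
    Summable fun n : ℤ => Real.exp (-(a - 2 * (n : ℝ)) ^ 2 / (4 * t)) := by
  have hpos : 0 < 1 / (Real.pi * t) := by positivity
  refine (HurwitzZeta.hasSum_int_evenKernel (-(a / 2)) hpos).summable.congr fun n => ?_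
  congr 1
  have := Real.pi_ne_zero
  field_simp
  ring

theorem exp_neg_sq_div_le_exp_neg_sq_div {s t : ℝ} (hs : 0 < s) (hst : s ≤ t) (a : ℝ) :
    Real.exp (-a ^ 2 / (4 * s)) ≤ Real.exp (-a ^ 2 / (4 * t)) := by
  rw [neg_div, neg_div]
  gcongr

theorem one_div_sqrt_mul_eq_sqrt_div_mul {c s t : ℝ} (hc : 0 ≤ c) (ht : 0 < t) :
    1 / Real.sqrt (c * s) = Real.sqrt (t / s) * (1 / Real.sqrt (c * t)) := by
  have := Real.sqrt_pos.2 ht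
  rw [Real.sqrt_mul hc, Real.sqrt_mul hc, Real.sqrt_div ht.le]
  field_simp

/-- For every `T > 0` there is `C = C(T) > 0` such that
`G_s(x,y) ≤ C √(t/s) G_t(x,y)` for all `x, y ∈ (0,1)` and `0 < s < t ≤ T`. -/
theorem green_monotone_comparison (T : ℝ) (hT : 0 < T) :
    ∃ C : ℝ, 0 < C ∧ ∀ x ∈ Set.Ioo (0:ℝ) 1, ∀ y ∈ Set.Ioo (0:ℝ) 1, ∀ s t : ℝ,
      0 < s → s < t → t ≤ T →
      G s x y ≤ C * Real.sqrt (t / s) * G t x y := by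
  refine ⟨1, one_pos, fun x _ y _ s t hs hst _ => ?_⟩
  have ht : 0 < t := hs.trans hst
  have summable_terms {r : ℝ} (hr : 0 < r) :=
    (summable_exp_neg_sub_two_mul_int_sq hr (x - y)).add
      (summable_exp_neg_sub_two_mul_int_sq hr (x + y))
  rw [one_mul, G, G, ← mul_assoc,
    ← one_div_sqrt_mul_eq_sqrt_div_mul (by positivity) ht]
  refine mul_le_mul_of_nonneg_left ?_ (by positivity)
  exact (summable_terms hs).tsum_le_tsum
    (fun n => add_le_add (exp_neg_sq_div_le_exp_neg_sq_div hs hst.le _)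
      (exp_neg_sq_div_le_exp_neg_sq_div hs hst.le _)) (summable_terms ht)
end

section
/- Let T > 0. For every ν ∈ (1/3, 1) there exists a constant C = C(T, ν) > 0 such that for all 0 < s < t ≤ T and all x, y ∈ (0,1), both ∫₀¹ |G_t(x,y) − G_s(x,y)| dx ≤ C s^{-ν} (t−s)^{ν} and ∫₀¹ |G_t(x,y) − G_s(x,y)| dy ≤ C s^{-ν} (t−s)^{ν}. -/
open MeasureTheory Real Filter

lemma summable_exp_neg_mul_int_sq {a : ℝ} (ha : 0 < a) :
    Summable fun n : ℤ => Real.exp (-(a * (n : ℝ) ^ 2)) := by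
  have h : Summable fun n : ℕ => Real.exp (-(a * (n : ℝ) ^ 2)) := by
    refine (Real.summable_exp_nat_mul_iff.mpr (neg_lt_zero.mpr ha)).of_nonneg_of_le
      (fun _ => by positivity) fun n => Real.exp_le_exp.mpr ?_
    have hn : (n : ℝ) ≤ (n : ℝ) ^ 2 := by exact_mod_cast Nat.le_self_pow two_ne_zero n
    nlinarith
  exact Summable.of_nat_of_neg (by simpa using h) (by simpa using h)

lemma exp_neg_sub_sq_div_le {t c M : ℝ} (ht : 0 < t) (hc : |c| ≤ M) (n : ℤ) :
    Real.exp (-(c - 2 * (n : ℝ)) ^ 2 / (4 * t)) ≤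
      Real.exp (M ^ 2 / (4 * t)) * Real.exp (-(1 / (2 * t) * (n : ℝ) ^ 2)) := by
  rw [← Real.exp_add, Real.exp_le_exp]
  have hM : c ^ 2 ≤ M ^ 2 := sq_le_sq' (by linarith [neg_abs_le c]) ((le_abs_self c).trans hc)
  have h : M ^ 2 / (4 * t) + -(1 / (2 * t) * (n : ℝ) ^ 2) =
      (M ^ 2 - 2 * (n : ℝ) ^ 2) / (4 * t) := by
    field_simp
    ring
  rw [h]
  gcongr
  nlinarith [sq_nonneg (c - n)]

lemma summable_gaussian_bound {t : ℝ} (ht : 0 < t) (M : ℝ) :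
    Summable fun n : ℤ =>
      Real.exp (M ^ 2 / (4 * t)) * Real.exp (-(1 / (2 * t) * (n : ℝ) ^ 2)) :=
  (summable_exp_neg_mul_int_sq (by positivity)).mul_left _

lemma summable_exp_neg_sub_sq_div {t : ℝ} (ht : 0 < t) (c : ℝ) :
    Summable fun n : ℤ => Real.exp (-(c - 2 * (n : ℝ)) ^ 2 / (4 * t)) :=
  (summable_gaussian_bound ht |c|).of_nonneg_of_le (fun _ => by positivity)
    (exp_neg_sub_sq_div_le ht le_rfl)

/-- Reflecting the summation index of the first family of images. -/
lemma G_eq_reflected {t : ℝ} (ht : 0 < t) (x y : ℝ) :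
    G t x y = (1 / Real.sqrt (4 * Real.pi * t)) *
      ∑' n : ℤ, (Real.exp (-(y - x - 2 * (n : ℝ)) ^ 2 / (4 * t)) +
        Real.exp (-(x + y - 2 * (n : ℝ)) ^ 2 / (4 * t))) := by
  have h : ∑' n : ℤ, Real.exp (-(x - y - 2 * (n : ℝ)) ^ 2 / (4 * t)) =
      ∑' n : ℤ, Real.exp (-(y - x - 2 * (n : ℝ)) ^ 2 / (4 * t)) := by
    rw [← (Equiv.neg ℤ).tsum_eq]
    refine tsum_congr fun n => ?_
    rw [Equiv.neg_apply, Int.cast_neg]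
    ring_nf
  rw [G, Summable.tsum_add (summable_exp_neg_sub_sq_div ht _) (summable_exp_neg_sub_sq_div ht _),
    Summable.tsum_add (summable_exp_neg_sub_sq_div ht _) (summable_exp_neg_sub_sq_div ht _), h]

lemma G_symm {t : ℝ} (ht : 0 < t) (x y : ℝ) : G t x y = G t y x := by
  rw [G_eq_reflected ht x y, G, add_comm x y]

lemma G_nonneg (t x y : ℝ) : 0 ≤ G t x y :=
  mul_nonneg (by positivity) (tsum_nonneg fun _ => by positivity)

lemma continuousOn_G_left {t : ℝ} (ht : 0 < t) (y : ℝ) :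
    ContinuousOn (fun x => G t x y) (Set.Icc 0 1) := by
  unfold G
  refine ContinuousOn.mul continuousOn_const ?_
  refine continuousOn_tsum (fun n => Continuous.continuousOn (by fun_prop))
    ((summable_gaussian_bound ht (1 + |y|)).add (summable_gaussian_bound ht (1 + |y|)))
    fun n x hx => ?_
  have hx' : |x| ≤ 1 := abs_le.mpr ⟨by linarith [hx.1], hx.2⟩
  rw [Real.norm_of_nonneg (by positivity)]
  exact add_le_add
    (exp_neg_sub_sq_div_le ht ((abs_sub x y).trans (by linarith)) n)
    (exp_neg_sub_sq_div_le ht ((abs_add_le x y).trans (by linarith)) n)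

lemma intervalIntegrable_G_left {t : ℝ} (ht : 0 < t) (y : ℝ) :
    IntervalIntegrable (fun x => G t x y) volume 0 1 :=
  (continuousOn_G_left ht y).intervalIntegrable_of_Icc zero_le_one

lemma intervalIntegral_images {k : ℝ → ℝ} (hk : Continuous k) (heven : ∀ z, k (-z) = k z)
    (y : ℝ) (n : ℤ) :
    ∫ x in (0:ℝ)..1, (k (y - x - 2 * (n : ℝ)) + k (x + y - 2 * (n : ℝ))) =
      2 * ∫ z in ((-y - 1) / 2 + n)..((-y - 1) / 2 + n + 1), k (2 * z) := by
  have h1 : ∫ x in (0:ℝ)..1, k (y - x - 2 * (n : ℝ)) =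
      ∫ z in (2 * n - y)..(2 * n - y + 1), k z := by
    rw [← intervalIntegral.integral_congr (f := fun x => k (x + (2 * n - y)))
      (fun x _ => by rw [← heven]; ring_nf), intervalIntegral.integral_comp_add_right]
    ring_nf
  have h2 : ∫ x in (0:ℝ)..1, k (x + y - 2 * (n : ℝ)) =
      ∫ z in (2 * n - y - 1)..(2 * n - y), k z := by
    rw [← intervalIntegral.integral_congr (f := fun x => k ((2 * n - y) - x))
      (fun x _ => by rw [← heven]; ring_nf), intervalIntegral.integral_comp_sub_left]
    ring_nf
  have h3 := intervalIntegral.smul_integral_comp_mul_left (a := (-y - 1) / 2 + n)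
    (b := (-y - 1) / 2 + n + 1) k 2
  rw [smul_eq_mul] at h3
  rw [intervalIntegral.integral_add (by apply Continuous.intervalIntegrable; fun_prop)
    (by apply Continuous.intervalIntegrable; fun_prop), h1, h2, h3, add_comm,
    intervalIntegral.integral_add_adjacent_intervals (hk.intervalIntegrable _ _)
    (hk.intervalIntegrable _ _)]
  congr 1 <;> ring

lemma integral_G_left {t : ℝ} (ht : 0 < t) (y : ℝ) : ∫ x in (0:ℝ)..1, G t x y = 1 := by
  set k : ℝ → ℝ := fun z => Real.exp (-z ^ 2 / (4 * t)) with hk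
  have hkc : Continuous k := by fun_prop
  have hgauss : (fun z => k (2 * z)) = fun z => Real.exp (-(1 / t) * z ^ 2) := by
    ext z
    simp only [hk]
    congr 1
    field_simp
    ring
  have hint : Integrable fun z => k (2 * z) := by
    rw [hgauss]
    exact integrable_exp_neg_mul_sq (by positivity)
  have hsum := (hint.hasSum_intervalIntegral ((-y - 1) / 2)).mul_left 2
  simp_rw [← intervalIntegral_images hkc (fun z => by simp [hk]) y] at hsum
  have hswap := hasSum_integral_of_summable_integral_norm (μ := volume.restrict (Set.Ioc 0 1))
    (F := fun (n : ℤ) (x : ℝ) => k (y - x - 2 * (n : ℝ)) + k (x + y - 2 * (n : ℝ)))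
    (fun n => (Continuous.integrableOn_Ioc (by fun_prop)))
    (by
      refine hsum.summable.congr fun n => ?_
      rw [intervalIntegral.integral_of_le zero_le_one]
      refine integral_congr_ae (ae_of_all _ fun x => ?_)
      exact (Real.norm_of_nonneg (add_nonneg (Real.exp_pos _).le (Real.exp_pos _).le)).symm)
  simp_rw [← intervalIntegral.integral_of_le (zero_le_one' ℝ)] at hswap
  have heq := hswap.unique hsum
  simp_rw [G_eq_reflected ht]
  rw [intervalIntegral.integral_const_mul, heq, hgauss, integral_gaussian]
  have h4 : Real.sqrt (4 * Real.pi * t) = 2 * Real.sqrt (Real.pi * t) := by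
    rw [mul_assoc, Real.sqrt_mul (by norm_num), show (4:ℝ) = 2 ^ 2 by norm_num,
      Real.sqrt_sq (by norm_num)]
  have hpos : 0 < Real.sqrt (Real.pi * t) := Real.sqrt_pos.mpr (by positivity)
  rw [h4, div_div_eq_mul_div, div_one]
  field_simp

lemma sqrt_div_mul_G_le {s t : ℝ} (hs : 0 < s) (hst : s < t) (x y : ℝ) :
    Real.sqrt (s / t) * G s x y ≤ G t x y := by
  have ht : 0 < t := hs.trans hst
  have hcoef : Real.sqrt (s / t) * (1 / Real.sqrt (4 * Real.pi * s)) =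
      1 / Real.sqrt (4 * Real.pi * t) := by
    rw [Real.sqrt_div hs.le, Real.sqrt_mul (by positivity) s, Real.sqrt_mul (by positivity) t]
    have := Real.sqrt_pos.mpr hs
    have := Real.sqrt_pos.mpr ht
    field_simp
  have hexp (c : ℝ) : Real.exp (-c ^ 2 / (4 * s)) ≤ Real.exp (-c ^ 2 / (4 * t)) := by
    rw [Real.exp_le_exp, neg_div, neg_div, neg_le_neg_iff]
    gcongr
  rw [G, G, ← mul_assoc, hcoef]
  refine mul_le_mul_of_nonneg_left (Summable.tsum_le_tsum
    (fun n => add_le_add (hexp _) (hexp _)) ?_ ?_) (by positivity) <;>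
  exact (summable_exp_neg_sub_sq_div ‹_› _).add (summable_exp_neg_sub_sq_div ‹_› _)

lemma integral_abs_G_sub_le {s t : ℝ} (hs : 0 < s) (hst : s < t) (y : ℝ) :
    ∫ x in (0:ℝ)..1, |G t x y - G s x y| ≤ 2 * (1 - Real.sqrt (s / t)) := by
  have ht : 0 < t := hs.trans hst
  set r := Real.sqrt (s / t) with hr
  have hr1 : r ≤ 1 := Real.sqrt_le_one.mpr ((div_le_one ht).mpr hst.le)
  have hIt := intervalIntegrable_G_left ht y
  have hIs := intervalIntegrable_G_left hs y
  calc ∫ x in (0:ℝ)..1, |G t x y - G s x y|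
      ≤ ∫ x in (0:ℝ)..1, (G t x y + (1 - 2 * r) * G s x y) := by
        refine intervalIntegral.integral_mono_on zero_le_one (hIt.sub hIs).abs
          (hIt.add (hIs.const_mul _)) fun x _ => ?_
        have h1 := sqrt_div_mul_G_le hs hst x y
        have h2 := mul_nonneg (sub_nonneg.mpr hr1) (G_nonneg s x y)
        rw [abs_le]
        constructor <;> linarith
    _ = 2 * (1 - r) := by
        rw [intervalIntegral.integral_add hIt (hIs.const_mul _),
          intervalIntegral.integral_const_mul, integral_G_left ht, integral_G_left hs]
        ring

lemma one_sub_sqrt_div_le {s t ν : ℝ} (hs : 0 < s) (hst : s < t) (hν0 : 0 ≤ ν) (hν1 : ν ≤ 1) :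
    1 - Real.sqrt (s / t) ≤ s ^ (-ν) * (t - s) ^ ν := by
  have ht : 0 < t := hs.trans hst
  have hts : 0 < t - s := sub_pos.mpr hst
  have hle : s / t ≤ 1 := (div_le_one ht).mpr hst.le
  calc 1 - Real.sqrt (s / t) ≤ 1 - s / t := by
        refine sub_le_sub_left (Real.le_sqrt_of_sq_le ?_) _
        have : 0 ≤ s / t := by positivity
        nlinarith
    _ = (t - s) / t := by field_simp
    _ ≤ ((t - s) / t) ^ ν :=
        Real.self_le_rpow_of_le_one (by positivity) ((div_le_one ht).mpr (by linarith)) hν1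
    _ ≤ ((t - s) / s) ^ ν := by gcongr
    _ = s ^ (-ν) * (t - s) ^ ν := by
        rw [Real.div_rpow hts.le hs.le, Real.rpow_neg hs.le]
        ring

/-- Time-Hölder continuity of the Neumann Green function in `L¹`: for `ν ∈ (1/3, 1)`
there is `C = C(T,ν) > 0` with
`∫₀¹ |G_t(x,y) − G_s(x,y)| dx ≤ C s^{-ν} (t−s)^ν` and
`∫₀¹ |G_t(x,y) − G_s(x,y)| dy ≤ C s^{-ν} (t−s)^ν` for `0 < s < t ≤ T`. -/
theorem green_time_holder_L1 (T : ℝ) (hT : 0 < T) (ν : ℝ) (hν : ν ∈ Set.Ioo (1/3 : ℝ) 1) :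
    ∃ C : ℝ, 0 < C ∧ ∀ s t : ℝ, 0 < s → s < t → t ≤ T →
      ∀ x ∈ Set.Ioo (0:ℝ) 1, ∀ y ∈ Set.Ioo (0:ℝ) 1,
      (∫ x' in (0:ℝ)..1, |G t x' y - G s x' y|) ≤ C * s ^ (-ν) * (t - s) ^ ν ∧
      (∫ y' in (0:ℝ)..1, |G t x y' - G s x y'|) ≤ C * s ^ (-ν) * (t - s) ^ ν := by
  refine ⟨2, two_pos, fun s t hs hst _ x _ y _ => ?_⟩
  have hbound : 2 * (1 - Real.sqrt (s / t)) ≤ 2 * s ^ (-ν) * (t - s) ^ ν := by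
    rw [mul_assoc]
    exact mul_le_mul_of_nonneg_left
      (one_sub_sqrt_div_le hs hst (by linarith [hν.1]) hν.2.le) two_pos.le
  refine ⟨(integral_abs_G_sub_le hs hst y).trans hbound, ?_⟩
  simp_rw [G_symm (hs.trans hst) x, G_symm hs x]
  exact (integral_abs_G_sub_le hs hst x).trans hbound
end

section
/- For every x ∈ [0,1], the limit lim_{t→0⁺} t^{1/2} ∫₀¹ G_t(x,y)² dy exists and equals 1/((1 + sgn(x(1−x))) √(2π)); that is, the limit equals 1/√(2π) if x ∈ {0,1} and equals 1/(2√(2π)) if x ∈ (0,1). -/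
open MeasureTheory Real Filter

theorem summable_gaussian_int : Summable fun n : ℤ => 2 * exp (1 - (n : ℝ) ^ 2 / 2) := by
  have h : Summable fun n : ℕ => 2 * exp (1 - (n : ℝ) ^ 2 / 2) := by
    have hgeom : Summable fun n : ℕ => 2 * exp 1 * exp ((n : ℝ) * (-(1 / 2))) :=
      (Real.summable_exp_nat_mul_iff.2 (by norm_num)).mul_left _
    refine hgeom.of_nonneg_of_le (fun n => by positivity) fun n => ?_
    rw [mul_assoc, ← Real.exp_add]
    have hn : (n : ℝ) ≤ (n : ℝ) ^ 2 := by exact_mod_cast Nat.le_self_pow two_ne_zero n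
    gcongr
    linarith
  exact Summable.of_nat_of_neg (by simpa using h) (by simpa using h)

theorem exp_neg_sq_div_le {a b c t : ℝ} (ht : 0 < t) (ht1 : t ≤ 1) (h0 : 0 ≤ b ^ 2 - a ^ 2)
    (hc : 4 * c ≤ b ^ 2 - a ^ 2) :
    exp (-b ^ 2 / (4 * t)) ≤ exp (-a ^ 2 / (4 * t)) * exp (-c) := by
  rw [← Real.exp_add]
  have h : (b ^ 2 - a ^ 2) / 4 ≤ (b ^ 2 - a ^ 2) / (4 * t) :=
    div_le_div_of_nonneg_left h0 (by positivity) (by linarith)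
  have h' : (b ^ 2 - a ^ 2) / (4 * t) = -a ^ 2 / (4 * t) - -b ^ 2 / (4 * t) := by ring
  gcongr
  linarith

/-- The `n`-th pair of reflected Gaussians in the Neumann heat kernel, without the prefactor. -/
noncomputable def imageTerm (t x y : ℝ) (n : ℤ) : ℝ :=
  exp (-(x - y - 2 * (n : ℝ)) ^ 2 / (4 * t)) + exp (-(x + y - 2 * (n : ℝ)) ^ 2 / (4 * t))

theorem imageTerm_nonneg (t x y : ℝ) (n : ℤ) : 0 ≤ imageTerm t x y n := by
  unfold imageTerm
  positivity

theorem imageTerm_le {t x y : ℝ} (ht : 0 < t) (ht1 : t ≤ 1) (hx : x ∈ Set.Icc (0 : ℝ) 1)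
    (hy : y ∈ Set.Icc (0 : ℝ) 1) (n : ℤ) :
    imageTerm t x y n ≤ exp (-(x - y) ^ 2 / (4 * t)) * (2 * exp (1 - (n : ℝ) ^ 2 / 2)) := by
  obtain ⟨hx0, hx1⟩ := hx
  obtain ⟨hy0, hy1⟩ := hy
  have hc : 1 - (n : ℝ) ^ 2 / 2 = -((n : ℝ) ^ 2 / 2 - 1) := by ring
  have key : ∀ b : ℝ, 0 ≤ b ^ 2 - (x - y) ^ 2 →
      4 * ((n : ℝ) ^ 2 / 2 - 1) ≤ b ^ 2 - (x - y) ^ 2 →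
      exp (-b ^ 2 / (4 * t)) ≤ exp (-(x - y) ^ 2 / (4 * t)) * exp (1 - (n : ℝ) ^ 2 / 2) :=
    fun b h0 h => hc ▸ exp_neg_sq_div_le ht ht1 h0 h
  have hcases : (n : ℝ) ≤ -1 ∨ (n : ℝ) = 0 ∨ 1 ≤ (n : ℝ) := by
    rcases lt_trichotomy n 0 with h | h | h
    · left; exact_mod_cast (by lia : n ≤ -1)
    · right; left; exact_mod_cast h
    · right; right; exact_mod_cast h
  have h1 := key (x - y - 2 * n)
    (by rcases hcases with h | h | h <;> nlinarith)
    (by rcases hcases with h | h | h <;> nlinarith [sq_nonneg ((n : ℝ) - 1), sq_nonneg ((n : ℝ) + 1)])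
  have h2 := key (x + y - 2 * n)
    (by
      have : (x + y - 2 * n) ^ 2 - (x - y) ^ 2 = 4 * ((n - x) * (n - y)) := by ring
      rw [this]
      rcases hcases with h | h | h
      · have := mul_nonneg (by linarith : 0 ≤ x - n) (by linarith : 0 ≤ y - n)
        linarith
      · rw [h]; nlinarith [mul_nonneg hx0 hy0]
      · have := mul_nonneg (by linarith : 0 ≤ n - x) (by linarith : 0 ≤ n - y)
        linarith)
    (by
      have : (x + y - 2 * n) ^ 2 - (x - y) ^ 2 = 4 * ((n - x) * (n - y)) := by ring
      rw [this]
      rcases hcases with h | h | h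
      · have := mul_le_mul (by linarith : -(n : ℝ) ≤ x - n) (by linarith : -(n : ℝ) ≤ y - n)
          (by linarith) (by linarith)
        nlinarith
      · rw [h]; nlinarith [mul_nonneg hx0 hy0]
      · have := mul_le_mul (by linarith : (n : ℝ) - 1 ≤ n - x) (by linarith : (n : ℝ) - 1 ≤ n - y)
          (by linarith) (by linarith)
        nlinarith [sq_nonneg ((n : ℝ) - 2)])
  unfold imageTerm
  linarith

theorem imageTerm_le_const {t x y : ℝ} (ht : 0 < t) (ht1 : t ≤ 1) (hx : x ∈ Set.Icc (0 : ℝ) 1)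
    (hy : y ∈ Set.Icc (0 : ℝ) 1) (n : ℤ) :
    imageTerm t x y n ≤ 2 * exp (1 - (n : ℝ) ^ 2 / 2) := by
  refine (imageTerm_le ht ht1 hx hy n).trans (mul_le_of_le_one_left (by positivity) ?_)
  rw [Real.exp_le_one_iff]
  exact div_nonpos_of_nonpos_of_nonneg (by nlinarith [sq_nonneg (x - y)]) (by positivity)

theorem tsum_imageTerm_le {t x y : ℝ} (ht : 0 < t) (ht1 : t ≤ 1) (hx : x ∈ Set.Icc (0 : ℝ) 1)
    (hy : y ∈ Set.Icc (0 : ℝ) 1) :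
    ∑' n : ℤ, imageTerm t x y n ≤
      exp (-(x - y) ^ 2 / (4 * t)) * ∑' n : ℤ, 2 * exp (1 - (n : ℝ) ^ 2 / 2) := by
  rw [← tsum_mul_left]
  have hs := summable_gaussian_int.mul_left (exp (-(x - y) ^ 2 / (4 * t)))
  exact Summable.tsum_le_tsum (imageTerm_le ht ht1 hx hy)
    (hs.of_nonneg_of_le (imageTerm_nonneg t x y) (imageTerm_le ht ht1 hx hy)) hs

theorem continuousOn_tsum_imageTerm {t x : ℝ} (ht : 0 < t) (ht1 : t ≤ 1)
    (hx : x ∈ Set.Icc (0 : ℝ) 1) :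
    ContinuousOn (fun y => ∑' n : ℤ, imageTerm t x y n) (Set.Icc 0 1) := by
  refine continuousOn_tsum (fun n => ?_) summable_gaussian_int fun n y hy => ?_
  · unfold imageTerm
    fun_prop
  · rw [Real.norm_of_nonneg (imageTerm_nonneg t x y n)]
    exact imageTerm_le_const ht ht1 hx hy n

/-- The Gaussian `exp (-w ^ 2 / (4 * t))` along `w = a + √t * z`, as `t → 0⁺`. -/
theorem tendsto_exp_neg_sq_div (a z : ℝ) :
    Tendsto (fun t : ℝ => exp (-(a + √t * z) ^ 2 / (4 * t))) (nhdsWithin 0 (Set.Ioi 0))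
      (nhds (if a = 0 then exp (-z ^ 2 / 4) else 0)) := by
  split_ifs with ha
  · refine tendsto_const_nhds.congr' ?_
    filter_upwards [self_mem_nhdsWithin] with t ht
    have ht : 0 < t := ht
    rw [ha, zero_add, mul_pow, Real.sq_sqrt ht.le]
    congr 1
    field_simp
  · refine Real.tendsto_exp_atBot.comp ?_
    have hnum : Tendsto (fun t : ℝ => -(a + √t * z) ^ 2 / 4) (nhdsWithin 0 (Set.Ioi 0))
        (nhds (-a ^ 2 / 4)) := by
      have : Continuous fun t : ℝ => -(a + √t * z) ^ 2 / 4 := by fun_prop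
      have h := (this.tendsto 0).mono_left (nhdsWithin_le_nhds (s := Set.Ioi 0))
      simpa using h
    have := hnum.neg_mul_atTop (by have := sq_pos_of_ne_zero ha; linarith)
      tendsto_inv_nhdsGT_zero
    refine this.congr fun t => ?_
    rw [← div_eq_mul_inv, div_div]

theorem tendsto_tsum_imageTerm {x z : ℝ} (hx : x ∈ Set.Icc (0 : ℝ) 1)
    (hz : ∀ᶠ t in nhdsWithin 0 (Set.Ioi 0), x + √t * z ∈ Set.Icc (0 : ℝ) 1) :
    Tendsto (fun t : ℝ => ∑' n : ℤ, imageTerm t x (x + √t * z) n) (nhdsWithin 0 (Set.Ioi 0))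
      (nhds (∑' n : ℤ, ((if n = 0 then exp (-z ^ 2 / 4) else 0) +
        (if x = n then exp (-z ^ 2 / 4) else 0)))) := by
  refine tendsto_tsum_of_dominated_convergence summable_gaussian_int (fun n => ?_) ?_
  · unfold imageTerm
    refine Tendsto.add ?_ ?_
    · convert tendsto_exp_neg_sq_div (2 * (n : ℝ)) z using 3 with t
      · ring_nf
      · simp
    · convert tendsto_exp_neg_sq_div (2 * (x - n)) z using 3 with t
      · ring_nf
      · simp [sub_eq_zero]
  · filter_upwards [hz, Ioc_mem_nhdsGT (zero_lt_one (α := ℝ))] with t hy ht n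
    rw [Real.norm_of_nonneg (imageTerm_nonneg t x _ n)]
    exact imageTerm_le_const ht.1 ht.2 hx hy n

theorem sqrt_mul_integral_G_sq {t x : ℝ} (ht : 0 < t) :
    √t * ∫ y in (0 : ℝ)..1, (G t x y) ^ 2 =
      1 / (4 * π) * ∫ z : ℝ, (Set.Icc (0 : ℝ) 1).indicator
        (fun y => (∑' n : ℤ, imageTerm t x y n) ^ 2) (x + √t * z) := by
  set f : ℝ → ℝ := (Set.Icc (0 : ℝ) 1).indicator fun y => (∑' n : ℤ, imageTerm t x y n) ^ 2
  have hst : 0 < √t := Real.sqrt_pos.2 ht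
  have hG : ∫ y in (0 : ℝ)..1, (G t x y) ^ 2 = 1 / (4 * π * t) * ∫ y, f y := by
    rw [integral_indicator measurableSet_Icc, ← integral_const_mul,
      intervalIntegral.integral_of_le zero_le_one, ← integral_Icc_eq_integral_Ioc]
    congr 1
    ext y
    change (1 / √(4 * π * t) * ∑' n : ℤ, imageTerm t x y n) ^ 2 = _
    rw [mul_pow, div_pow, one_pow, Real.sq_sqrt (by positivity)]
  have hcomp : ∫ z, f (x + √t * z) = (√t)⁻¹ * ∫ y, f y := by
    rw [Measure.integral_comp_mul_left (fun y => f (x + y)), integral_add_left_eq_self,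
      abs_of_pos (inv_pos.2 hst), smul_eq_mul]
  rw [hG, hcomp]
  nth_rewrite 2 [← Real.sq_sqrt ht.le]
  field_simp

theorem tendsto_sqrt_mul_integral_G_sq {x k : ℝ} {A : Set ℝ} (hx : x ∈ Set.Icc (0 : ℝ) 1)
    (hA : MeasurableSet A)
    (hin : ∀ z ∈ A, ∀ᶠ t in nhdsWithin 0 (Set.Ioi 0), x + √t * z ∈ Set.Icc (0 : ℝ) 1)
    (hout : ∀ᵐ z : ℝ, z ∉ A → ∀ᶠ t in nhdsWithin 0 (Set.Ioi 0), x + √t * z ∉ Set.Icc (0 : ℝ) 1)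
    (hk : ∀ c : ℝ, ∑' n : ℤ, ((if n = 0 then c else 0) + (if x = n then c else 0)) = k * c) :
    Tendsto (fun t : ℝ => √t * ∫ y in (0 : ℝ)..1, (G t x y) ^ 2) (nhdsWithin 0 (Set.Ioi 0))
      (nhds (1 / (4 * π) * (k ^ 2 * ∫ z in A, exp (-(1 / 2) * z ^ 2)))) := by
  have hexp : ∀ z : ℝ, exp (-z ^ 2 / 4) ^ 2 = exp (-(1 / 2) * z ^ 2) := fun z => by
    rw [← Real.exp_nat_mul]
    congr 1
    push_cast
    ring
  set C : ℝ := ∑' n : ℤ, 2 * exp (1 - (n : ℝ) ^ 2 / 2)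
  have hlim : Tendsto (fun t : ℝ => ∫ z : ℝ, (Set.Icc (0 : ℝ) 1).indicator
        (fun y => (∑' n : ℤ, imageTerm t x y n) ^ 2) (x + √t * z)) (nhdsWithin 0 (Set.Ioi 0))
      (nhds (∫ z, A.indicator (fun z => k ^ 2 * exp (-(1 / 2) * z ^ 2)) z)) := by
    refine tendsto_integral_filter_of_dominated_convergence
      (fun z => C ^ 2 * exp (-(1 / 2) * z ^ 2)) ?_ ?_
      ((integrable_exp_neg_mul_sq (by norm_num)).const_mul _) ?_
    · filter_upwards [Ioc_mem_nhdsGT (zero_lt_one (α := ℝ))] with t ht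
      have hm : Measurable ((Set.Icc (0 : ℝ) 1).indicator
          fun y => (∑' n : ℤ, imageTerm t x y n) ^ 2) := by
        rw [← Set.piecewise_eq_indicator]
        exact ((continuousOn_tsum_imageTerm ht.1 ht.2 hx).pow 2).measurable_piecewise
          continuousOn_const measurableSet_Icc
      exact (hm.comp (by fun_prop : Measurable fun z : ℝ => x + √t * z)).aestronglyMeasurable
    · filter_upwards [Ioc_mem_nhdsGT (zero_lt_one (α := ℝ))] with t ht
      refine ae_of_all _ fun z => ?_
      by_cases hy : x + √t * z ∈ Set.Icc (0 : ℝ) 1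
      · rw [Set.indicator_of_mem hy, Real.norm_of_nonneg (sq_nonneg _), ← hexp, ← mul_pow]
        refine pow_le_pow_left₀ (tsum_nonneg (imageTerm_nonneg t x _)) ?_ 2
        refine (tsum_imageTerm_le ht.1 ht.2 hx hy).trans_eq ?_
        have ht0 := ht.1
        rw [mul_comm, sub_add_cancel_left, neg_sq, mul_pow, Real.sq_sqrt ht0.le]
        congr 2
        field_simp
      · rw [Set.indicator_of_notMem hy, norm_zero]
        positivity
    · filter_upwards [hout] with z hz
      by_cases hzA : z ∈ A
      · rw [Set.indicator_of_mem hzA, ← hexp, ← mul_pow, ← hk]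
        refine ((tendsto_tsum_imageTerm hx (hin z hzA)).pow 2).congr' ?_
        filter_upwards [hin z hzA] with t ht
        rw [Set.indicator_of_mem ht]
      · rw [Set.indicator_of_notMem hzA]
        refine tendsto_const_nhds.congr' ?_
        filter_upwards [hz hzA] with t ht
        rw [Set.indicator_of_notMem ht]
  rw [integral_indicator hA, integral_const_mul] at hlim
  refine (hlim.const_mul _).congr' ?_
  filter_upwards [self_mem_nhdsWithin] with t ht
  exact (sqrt_mul_integral_G_sq ht).symm

theorem tendsto_add_sqrt_mul (x z : ℝ) :
    Tendsto (fun t : ℝ => x + √t * z) (nhdsWithin 0 (Set.Ioi 0)) (nhds x) := by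
  have : Continuous fun t : ℝ => x + √t * z := by fun_prop
  simpa using (this.tendsto 0).mono_left (nhdsWithin_le_nhds (s := Set.Ioi 0))

theorem tsum_ite_add_ite {x : ℝ} {m : ℤ} (hm : x = m) (c : ℝ) :
    ∑' n : ℤ, ((if n = 0 then c else 0) + (if x = n then c else 0)) = 2 * c := by
  have h : ∀ n : ℤ, (x = n) = (n = m) := fun n => by
    rw [hm, Int.cast_inj, eq_comm (a := m)]
  simp only [h]
  rw [((hasSum_ite_eq 0 c).add (hasSum_ite_eq m c)).tsum_eq, two_mul]

theorem one_div_sqrt_two_pi : 1 / √(2 * π) = √(2 * π) / (2 * π) := by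
  rw [Real.sqrt_div_self']

/-- `lim_{t→0⁺} √t ∫₀¹ G_t(x,y)² dy = 1/((1 + sgn(x(1−x))) √(2π))` for `x ∈ [0,1]`. -/
theorem green_sq_integral_small_time_limit (x : ℝ) (hx : x ∈ Set.Icc (0:ℝ) 1) :
    Tendsto (fun t : ℝ => Real.sqrt t * ∫ y in (0:ℝ)..1, (G t x y) ^ 2)
      (nhdsWithin 0 (Set.Ioi 0))
      (nhds (1 / ((1 + Real.sign (x * (1 - x))) * Real.sqrt (2 * Real.pi)))) := by
  have hbdry : 1 / (4 * π) * ((2 : ℝ) ^ 2 * (√(2 * π) / 2)) = 1 / √(2 * π) := by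
    rw [one_div_sqrt_two_pi]
    field_simp
    norm_num
  have hIoi : ∫ z in Set.Ioi (0 : ℝ), exp (-(1 / 2) * z ^ 2) = √(2 * π) / 2 := by
    rw [integral_gaussian_Ioi]
    congr 2
    ring
  have hIio : ∫ z in Set.Iio (0 : ℝ), exp (-(1 / 2) * z ^ 2) = √(2 * π) / 2 := by
    have h := integral_comp_neg_Ioi (0 : ℝ) fun z => exp (-(1 / 2) * z ^ 2)
    simp only [neg_sq, neg_zero] at h
    rw [← hIoi, ← integral_Iic_eq_integral_Iio, h]
  rcases eq_or_lt_of_le hx.1 with rfl | h0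
  · have h := tendsto_sqrt_mul_integral_G_sq (k := 2) hx (measurableSet_Ioi (a := (0 : ℝ))) ?_ ?_
      (tsum_ite_add_ite (m := 0) (by simp))
    · rw [hIoi, hbdry] at h
      simpa using h
    · intro z hz
      filter_upwards [(tendsto_add_sqrt_mul 0 z).eventually_lt_const one_pos] with t ht
      have hz : 0 < z := hz
      exact ⟨by positivity, ht.le⟩
    · filter_upwards [Measure.ae_ne volume (0 : ℝ)] with z hz0 hz
      have hz : z < 0 := lt_of_le_of_ne (not_lt.1 hz) hz0
      filter_upwards [self_mem_nhdsWithin] with t ht hy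
      have := mul_neg_of_pos_of_neg (Real.sqrt_pos.2 ht) hz
      linarith [hy.1]
  rcases eq_or_lt_of_le hx.2 with rfl | h1
  · have h := tendsto_sqrt_mul_integral_G_sq (k := 2) hx (measurableSet_Iio (a := (0 : ℝ))) ?_ ?_
      (tsum_ite_add_ite (m := 1) (by simp))
    · rw [hIio, hbdry] at h
      simpa using h
    · intro z hz
      filter_upwards [(tendsto_add_sqrt_mul 1 z).eventually_const_lt one_pos] with t ht
      have := mul_nonpos_of_nonneg_of_nonpos (Real.sqrt_nonneg t) (le_of_lt hz)
      exact ⟨ht.le, by linarith⟩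
    · filter_upwards [Measure.ae_ne volume (0 : ℝ)] with z hz0 hz
      have hz : 0 < z := lt_of_le_of_ne (not_lt.1 hz) hz0.symm
      filter_upwards [self_mem_nhdsWithin] with t ht hy
      have := mul_pos (Real.sqrt_pos.2 ht) hz
      linarith [hy.2]
  · have h := tendsto_sqrt_mul_integral_G_sq (k := 1) hx MeasurableSet.univ
      (fun z _ => (tendsto_add_sqrt_mul x z).eventually (Icc_mem_nhds h0 h1)) (by simp) ?_
    · rw [Measure.restrict_univ, integral_gaussian] at h
      convert h using 2
      rw [Real.sign_of_pos (mul_pos h0 (sub_pos.2 h1)), one_div_mul_eq_div,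
        (by ring : π / (1 / 2) = 2 * π), ← one_div_mul_one_div, one_div_sqrt_two_pi]
      field_simp
      norm_num
    · intro c
      have hne : ∀ n : ℤ, x ≠ n := by
        rintro n rfl
        have : 0 < n := by exact_mod_cast h0
        have : n < 1 := by exact_mod_cast h1
        lia
      simp [hne]
end

section
/- There exist absolute constants C, C̃ > 0 (independent of t, β, σ) such that for every β ≥ 0, every σ ∈ ℝ, every t ∈ (0,1] and every x ∈ (0,1): C σ² t^{1/2} e^{−2βt} ≤ ∫₀ᵗ ∫₀¹ e^{−2βr} σ² G_r(x,z)² dz dr ≤ ∫₀ᵗ ∫₀¹ e^{2βr} σ² G_r(x,z)² dz dr ≤ C̃ σ² t^{1/2} e^{2βt}. -/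
open MeasureTheory Real Filter

theorem summable_exp_neg_int_sq_sub_self :
    Summable fun n : ℤ => Real.exp (-((n : ℝ) ^ 2 - n) / 16) := by
  refine (summable_pow_mul_jacobiTheta₂_term_bound (1 / (32 * π))
    (T := 1 / (16 * π)) (by positivity) 0).of_nonneg_of_le (fun n => (Real.exp_pos _).le) fun n => ?_
  rw [pow_zero, one_mul, Real.exp_le_exp]
  have h : (n : ℝ) ≤ |(n : ℝ)| := le_abs_self _
  push_cast
  have e : -π * (1 / (16 * π) * (n : ℝ) ^ 2 - 2 * (1 / (32 * π)) * |(n : ℝ)|)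
      = -((n : ℝ) ^ 2 - |(n : ℝ)|) / 16 := by
    field_simp
    ring
  rw [e]
  linarith

theorem sq_sub_two_mul_int_lower_bound {d : ℝ} (hd : |d| ≤ 1) (n : ℤ) :
    d ^ 2 / 2 + ((n : ℝ) ^ 2 - n) / 4 ≤ (d - 2 * n) ^ 2 := by
  obtain ⟨h1, h2⟩ := abs_le.1 hd
  rcases lt_trichotomy n 0 with h | rfl | h
  · have : (n : ℝ) ≤ -1 := by exact_mod_cast Int.le_sub_one_of_lt h
    nlinarith [mul_nonneg (sub_nonneg.2 h1) (sub_nonneg.2 this)]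
  · norm_num
    nlinarith [sq_nonneg d]
  · have : (1 : ℝ) ≤ n := by exact_mod_cast h
    nlinarith [mul_nonneg (sub_nonneg.2 h2) (sub_nonneg.2 this)]

theorem sq_add_sub_two_mul_int_lower_bound {x z : ℝ} (hx : x ∈ Set.Icc (0 : ℝ) 1)
    (hz : z ∈ Set.Icc (0 : ℝ) 1) (n : ℤ) :
    (x - z) ^ 2 / 2 + ((n : ℝ) ^ 2 - n) / 4 ≤ (x + z - 2 * n) ^ 2 := by
  obtain ⟨hx0, hx1⟩ := hx
  obtain ⟨hz0, hz1⟩ := hz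
  rcases le_or_gt n 0 with h | h
  · have hn : (n : ℝ) ≤ 0 := by exact_mod_cast h
    have hd : (x - z) ^ 2 ≤ (x + z - 2 * n) ^ 2 := by
      apply sq_le_sq' <;> linarith
    have hw : (2 * (n : ℝ)) ^ 2 ≤ (x + z - 2 * n) ^ 2 := by
      apply sq_le_sq' <;> linarith
    have hq : -(n : ℝ) ≤ (n : ℝ) ^ 2 := by
      have : -n ≤ n ^ 2 := by nlinarith [Int.le_self_sq (-n)]
      exact_mod_cast this
    nlinarith [sq_nonneg (n : ℝ)]
  · have hn : (1 : ℝ) ≤ n := by exact_mod_cast h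
    have hd : (x - z) ^ 2 ≤ (2 * n - (x + z)) ^ 2 := by
      apply sq_le_sq' <;> linarith
    have hw : (2 * ((n : ℝ) - 1)) ^ 2 ≤ (2 * n - (x + z)) ^ 2 := by
      apply sq_le_sq' <;> linarith
    have hq : (n : ℝ) - 1 ≤ ((n : ℝ) - 1) ^ 2 := by
      exact_mod_cast Int.le_self_sq (n - 1)
    nlinarith

theorem exp_neg_div_le {r a b c : ℝ} (hr : r ∈ Set.Ioc (0 : ℝ) 1) (hc : 0 ≤ c)
    (h : b / 2 + c / 4 ≤ a) :
    Real.exp (-a / (4 * r)) ≤ Real.exp (-b / (8 * r)) * Real.exp (-c / 16) := by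
  obtain ⟨hr0, hr1⟩ := hr
  rw [← Real.exp_add, Real.exp_le_exp]
  have h1 : (b / 2 + c / 4) / (4 * r) ≤ a / (4 * r) := by gcongr
  have h2 : (b / 2 + c / 4) / (4 * r) = b / (8 * r) + c / (16 * r) := by
    field_simp
    ring
  have h3 : c / 16 ≤ c / (16 * r) := by
    apply div_le_div_of_nonneg_left hc (by positivity)
    linarith
  rw [neg_div, neg_div, neg_div]
  linarith

theorem int_sq_sub_self_nonneg (n : ℤ) : 0 ≤ (n : ℝ) ^ 2 - n := by
  rw [sub_nonneg]
  exact_mod_cast Int.le_self_sq n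

theorem green_summand_le {r x z : ℝ} (hr : r ∈ Set.Ioc (0 : ℝ) 1)
    (hx : x ∈ Set.Icc (0 : ℝ) 1) (hz : z ∈ Set.Icc (0 : ℝ) 1) (n : ℤ) :
    Real.exp (-(x - z - 2 * (n : ℝ)) ^ 2 / (4 * r)) +
      Real.exp (-(x + z - 2 * (n : ℝ)) ^ 2 / (4 * r)) ≤
    2 * Real.exp (-(x - z) ^ 2 / (8 * r)) * Real.exp (-((n : ℝ) ^ 2 - n) / 16) := by
  have hd : |x - z| ≤ 1 := by
    rw [abs_le]
    constructor <;> linarith [hx.1, hx.2, hz.1, hz.2]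
  have h1 := exp_neg_div_le hr (int_sq_sub_self_nonneg n) (sq_sub_two_mul_int_lower_bound hd n)
  have h2 := exp_neg_div_le hr (int_sq_sub_self_nonneg n)
    (sq_add_sub_two_mul_int_lower_bound hx hz n)
  linarith

theorem summable_green_summand {r x z : ℝ} (hr : r ∈ Set.Ioc (0 : ℝ) 1)
    (hx : x ∈ Set.Icc (0 : ℝ) 1) (hz : z ∈ Set.Icc (0 : ℝ) 1) :
    Summable fun n : ℤ => Real.exp (-(x - z - 2 * (n : ℝ)) ^ 2 / (4 * r)) +
      Real.exp (-(x + z - 2 * (n : ℝ)) ^ 2 / (4 * r)) :=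
  (summable_exp_neg_int_sq_sub_self.mul_left _).of_nonneg_of_le (fun n => by positivity)
    (green_summand_le hr hx hz)

theorem G_nonneg_s12 (r x z : ℝ) : 0 ≤ G r x z :=
  mul_nonneg (by positivity) (tsum_nonneg fun n => by positivity)

theorem G_le {r x z : ℝ} (hr : r ∈ Set.Ioc (0 : ℝ) 1)
    (hx : x ∈ Set.Icc (0 : ℝ) 1) (hz : z ∈ Set.Icc (0 : ℝ) 1) :
    G r x z ≤ 1 / √(4 * π * r) * (2 * Real.exp (-(x - z) ^ 2 / (8 * r)) *
      ∑' n : ℤ, Real.exp (-((n : ℝ) ^ 2 - n) / 16)) := by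
  unfold G
  gcongr
  rw [← tsum_mul_left]
  exact (summable_green_summand hr hx hz).tsum_le_tsum (green_summand_le hr hx hz)
    (summable_exp_neg_int_sq_sub_self.mul_left _)

theorem le_G {r x z : ℝ} (hr : r ∈ Set.Ioc (0 : ℝ) 1)
    (hx : x ∈ Set.Icc (0 : ℝ) 1) (hz : z ∈ Set.Icc (0 : ℝ) 1) :
    1 / √(4 * π * r) * Real.exp (-(x - z) ^ 2 / (4 * r)) ≤ G r x z := by
  unfold G
  gcongr
  refine le_trans ?_ ((summable_green_summand hr hx hz).le_tsum 0 fun n _ => by positivity)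
  simpa using (Real.exp_pos _).le

theorem measurable_G (x : ℝ) : Measurable fun p : ℝ × ℝ => G p.1 x p.2 := by
  unfold G
  refine Measurable.mul (by fun_prop) (Measurable.tsum fun n => by fun_prop)

theorem G_sq_le {r x z : ℝ} (hr : r ∈ Set.Ioc (0 : ℝ) 1)
    (hx : x ∈ Set.Icc (0 : ℝ) 1) (hz : z ∈ Set.Icc (0 : ℝ) 1) :
    G r x z ^ 2 ≤ (∑' n : ℤ, Real.exp (-((n : ℝ) ^ 2 - n) / 16)) ^ 2 / (π * r) *
      Real.exp (-(1 / (4 * r)) * (z - x) ^ 2) := by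
  have hr0 := hr.1
  refine (pow_le_pow_left₀ (G_nonneg_s12 r x z) (G_le hr hx hz) 2).trans_eq ?_
  have e : Real.exp (-(1 / (4 * r)) * (z - x) ^ 2) = Real.exp (-(x - z) ^ 2 / (8 * r)) ^ 2 := by
    rw [← Real.exp_nat_mul]
    congr 1
    field_simp
    push_cast
    ring
  rw [e, mul_pow, mul_pow, mul_pow, div_pow, Real.sq_sqrt (by positivity)]
  field_simp
  ring

theorem intervalIntegrable_G_sq {r x : ℝ} (hr : r ∈ Set.Ioc (0 : ℝ) 1)
    (hx : x ∈ Set.Icc (0 : ℝ) 1) :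
    IntervalIntegrable (fun z => G r x z ^ 2) volume 0 1 := by
  have hc : Continuous fun z : ℝ => (∑' n : ℤ, Real.exp (-((n : ℝ) ^ 2 - n) / 16)) ^ 2 / (π * r) *
      Real.exp (-(1 / (4 * r)) * (z - x) ^ 2) := by fun_prop
  refine (hc.intervalIntegrable 0 1).mono_fun
    (((measurable_G x).comp measurable_prodMk_left).pow_const 2).aestronglyMeasurable ?_
  filter_upwards [ae_restrict_mem measurableSet_uIoc] with z hz
  rw [Set.uIoc_of_le zero_le_one] at hz
  rw [Real.norm_of_nonneg (sq_nonneg _)]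
  exact (G_sq_le hr hx (Set.Ioc_subset_Icc_self hz)).trans (le_abs_self _)

theorem integral_G_sq_le {r x : ℝ} (hr : r ∈ Set.Ioc (0 : ℝ) 1) (hx : x ∈ Set.Icc (0 : ℝ) 1) :
    ∫ z in (0 : ℝ)..1, G r x z ^ 2 ≤
      2 * (∑' n : ℤ, Real.exp (-((n : ℝ) ^ 2 - n) / 16)) ^ 2 / √π * r ^ (-(1 / 2) : ℝ) := by
  have hr0 := hr.1
  have hb : 0 < 1 / (4 * r) := by positivity
  have hi : Integrable fun z : ℝ => Real.exp (-(1 / (4 * r)) * (z - x) ^ 2) :=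
    (integrable_exp_neg_mul_sq hb).comp_sub_right x
  have hgauss : ∫ z in (0 : ℝ)..1, Real.exp (-(1 / (4 * r)) * (z - x) ^ 2) ≤ 2 * √π * √r := by
    rw [intervalIntegral.integral_of_le zero_le_one]
    refine (setIntegral_le_integral hi (.of_forall fun z => (Real.exp_pos _).le)).trans_eq ?_
    rw [integral_sub_right_eq_self (fun z : ℝ => Real.exp (-(1 / (4 * r)) * z ^ 2)) x,
      integral_gaussian]
    rw [show π / (1 / (4 * r)) = 2 ^ 2 * (π * r) by field_simp; norm_num,
      Real.sqrt_mul (by positivity), Real.sqrt_sq (by norm_num), Real.sqrt_mul (by positivity)]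
    ring
  calc ∫ z in (0 : ℝ)..1, G r x z ^ 2
      ≤ ∫ z in (0 : ℝ)..1, (∑' n : ℤ, Real.exp (-((n : ℝ) ^ 2 - n) / 16)) ^ 2 / (π * r) *
          Real.exp (-(1 / (4 * r)) * (z - x) ^ 2) :=
        intervalIntegral.integral_mono_on zero_le_one (intervalIntegrable_G_sq hr hx)
          (hi.intervalIntegrable.const_mul _) fun z hz => G_sq_le hr hx hz
    _ ≤ (∑' n : ℤ, Real.exp (-((n : ℝ) ^ 2 - n) / 16)) ^ 2 / (π * r) * (2 * √π * √r) := by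
        rw [intervalIntegral.integral_const_mul]
        gcongr
    _ = _ := by
        rw [Real.rpow_neg hr0.le, ← Real.sqrt_eq_rpow]
        have hp : √π ^ 2 = π := Real.sq_sqrt Real.pi_pos.le
        have hs : √r ^ 2 = r := Real.sq_sqrt hr0.le
        have hp0 : 0 < √π := Real.sqrt_pos.2 Real.pi_pos
        have hs0 : 0 < √r := Real.sqrt_pos.2 hr0
        rw [← hp, ← hs, Real.sqrt_sq hp0.le, Real.sqrt_sq hs0.le]
        field_simp

theorem le_integral_G_sq {r x : ℝ} (hr : r ∈ Set.Ioc (0 : ℝ) 1) (hx : x ∈ Set.Icc (0 : ℝ) 1) :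
    Real.exp (-(1 / 8)) / (8 * π) * r ^ (-(1 / 2) : ℝ) ≤ ∫ z in (0 : ℝ)..1, G r x z ^ 2 := by
  have hr0 := hr.1
  have hs0 : 0 < √r := Real.sqrt_pos.2 hr0
  have hs1 : √r ≤ 1 := Real.sqrt_le_one.2 hr.2
  have hs : √r ^ 2 = r := Real.sq_sqrt hr0.le
  obtain ⟨u, hu0, hu1, hux, hxu⟩ : ∃ u : ℝ, 0 ≤ u ∧ u + √r / 2 ≤ 1 ∧ u ≤ x ∧ x ≤ u + √r / 2 := by
    rcases le_total x (1 / 2) with h | h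
    · exact ⟨x, hx.1, by linarith, le_rfl, by linarith⟩
    · exact ⟨x - √r / 2, by linarith, by linarith [hx.2], by linarith, by linarith⟩
  have hle : u ≤ u + √r / 2 := by linarith
  have hint := intervalIntegrable_G_sq hr hx
  calc Real.exp (-(1 / 8)) / (8 * π) * r ^ (-(1 / 2) : ℝ)
      = ∫ z in u..(u + √r / 2), Real.exp (-(1 / 8)) / (4 * π * r) := by
        rw [intervalIntegral.integral_const, Real.rpow_neg hr0.le, ← Real.sqrt_eq_rpow, smul_eq_mul,
          add_sub_cancel_left]
        nth_rewrite 3 [← hs]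
        field_simp
        norm_num
    _ ≤ ∫ z in u..(u + √r / 2), G r x z ^ 2 := by
        refine intervalIntegral.integral_mono_on hle intervalIntegrable_const
          (hint.mono_set ?_) fun z hz => ?_
        · rw [Set.uIcc_of_le hle, Set.uIcc_of_le zero_le_one]
          exact Set.Icc_subset_Icc hu0 hu1
        · refine le_trans ?_ (pow_le_pow_left₀ (by positivity)
            (le_G hr hx ⟨hu0.trans hz.1, hz.2.trans hu1⟩) 2)
          rw [mul_pow, div_pow, Real.sq_sqrt (by positivity), ← Real.exp_nat_mul, one_pow,
            div_mul_eq_mul_div, one_mul]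
          gcongr
          have hd : (x - z) ^ 2 ≤ (√r / 2) ^ 2 := by
            apply sq_le_sq' <;> linarith [hz.1, hz.2]
          rw [div_pow, hs] at hd
          rw [neg_div, mul_neg, neg_le_neg_iff]
          push_cast
          rw [← mul_div_assoc, div_le_div_iff₀ (by positivity) (by norm_num)]
          linarith
    _ ≤ ∫ z in (0 : ℝ)..1, G r x z ^ 2 :=
        intervalIntegral.integral_mono_interval hu0 hle hu1
          (.of_forall fun z => sq_nonneg _) hint

theorem intervalIntegrable_integral_G_sq {t x : ℝ} (ht : t ∈ Set.Ioc (0 : ℝ) 1)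
    (hx : x ∈ Set.Icc (0 : ℝ) 1) :
    IntervalIntegrable (fun r => ∫ z in (0 : ℝ)..1, G r x z ^ 2) volume 0 t := by
  have hm : StronglyMeasurable fun r => ∫ z in (0 : ℝ)..1, G r x z ^ 2 := by
    simp only [intervalIntegral.integral_of_le zero_le_one]
    exact ((measurable_G x).pow_const 2).stronglyMeasurable.integral_prod_right'
  refine ((intervalIntegral.intervalIntegrable_rpow' (a := 0) (b := t)
    (r := -(1 / 2)) (by norm_num)).const_mul
    (2 * (∑' n : ℤ, Real.exp (-((n : ℝ) ^ 2 - n) / 16)) ^ 2 / √π)).mono_fun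
    hm.aestronglyMeasurable ?_
  filter_upwards [ae_restrict_mem measurableSet_uIoc] with r hr
  rw [Set.uIoc_of_le ht.1.le] at hr
  rw [Real.norm_of_nonneg (intervalIntegral.integral_nonneg zero_le_one fun z _ => sq_nonneg _)]
  exact (integral_G_sq_le ⟨hr.1, hr.2.trans ht.2⟩ hx).trans (le_abs_self _)

theorem integral_rpow_neg_half (t : ℝ) :
    ∫ r in (0 : ℝ)..t, r ^ (-(1 / 2) : ℝ) = 2 * √t := by
  rw [integral_rpow (Or.inl (by norm_num)), Real.sqrt_eq_rpow]
  norm_num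
  ring

/-- There are absolute constants `C, C̃ > 0` such that for all `β ≥ 0`, `σ ∈ ℝ`,
`t ∈ (0,1]` and `x ∈ (0,1)`:
`C σ² √t e^{−2βt} ≤ ∫₀ᵗ∫₀¹ e^{−2βr} σ² G_r(x,z)² dz dr
  ≤ ∫₀ᵗ∫₀¹ e^{2βr} σ² G_r(x,z)² dz dr ≤ C̃ σ² √t e^{2βt}`. -/
theorem malliavin_variance_bounds :
    ∃ C : ℝ, 0 < C ∧ ∃ C' : ℝ, 0 < C' ∧ ∀ β : ℝ, 0 ≤ β → ∀ σ : ℝ,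
      ∀ t ∈ Set.Ioc (0:ℝ) 1, ∀ x ∈ Set.Ioo (0:ℝ) 1,
      C * σ ^ 2 * Real.sqrt t * Real.exp (-2 * β * t) ≤
        (∫ r in (0:ℝ)..t, ∫ z in (0:ℝ)..1, Real.exp (-2 * β * r) * σ ^ 2 * (G r x z) ^ 2) ∧
      (∫ r in (0:ℝ)..t, ∫ z in (0:ℝ)..1, Real.exp (-2 * β * r) * σ ^ 2 * (G r x z) ^ 2) ≤
        (∫ r in (0:ℝ)..t, ∫ z in (0:ℝ)..1, Real.exp (2 * β * r) * σ ^ 2 * (G r x z) ^ 2) ∧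
      (∫ r in (0:ℝ)..t, ∫ z in (0:ℝ)..1, Real.exp (2 * β * r) * σ ^ 2 * (G r x z) ^ 2) ≤
        C' * σ ^ 2 * Real.sqrt t * Real.exp (2 * β * t) := by
  set S : ℝ := ∑' n : ℤ, Real.exp (-((n : ℝ) ^ 2 - n) / 16)
  have hS0 : 0 < S :=
    summable_exp_neg_int_sq_sub_self.tsum_pos (fun n => (Real.exp_pos _).le) 0 (Real.exp_pos _)
  refine ⟨2 * (Real.exp (-(1 / 8)) / (8 * π)), by positivity, 2 * (2 * S ^ 2 / √π),
    by positivity, fun β hβ σ t ht x hx => ?_⟩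
  replace hx := Set.Ioo_subset_Icc_self hx
  have ht0 := ht.1.le
  have hI := intervalIntegrable_integral_G_sq ht hx
  have hP : IntervalIntegrable (fun r : ℝ => r ^ (-(1 / 2) : ℝ)) volume 0 t :=
    intervalIntegral.intervalIntegrable_rpow' (by norm_num)
  have hJ (k : ℝ) : IntervalIntegrable
      (fun r => Real.exp (k * r) * σ ^ 2 * ∫ z in (0 : ℝ)..1, G r x z ^ 2) volume 0 t :=
    hI.continuousOn_mul (by fun_prop)
  have hJ0 (r : ℝ) : 0 ≤ ∫ z in (0 : ℝ)..1, G r x z ^ 2 :=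
    intervalIntegral.integral_nonneg zero_le_one fun z _ => sq_nonneg _
  simp only [intervalIntegral.integral_const_mul]
  refine ⟨?_, ?_, ?_⟩
  · calc 2 * (Real.exp (-(1 / 8)) / (8 * π)) * σ ^ 2 * √t * Real.exp (-2 * β * t)
        = ∫ r in (0 : ℝ)..t, Real.exp (-2 * β * t) * σ ^ 2 *
            (Real.exp (-(1 / 8)) / (8 * π) * r ^ (-(1 / 2) : ℝ)) := by
          rw [intervalIntegral.integral_const_mul, intervalIntegral.integral_const_mul,
            integral_rpow_neg_half]
          ring
      _ ≤ _ := by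
          refine intervalIntegral.integral_mono_on_of_le_Ioo ht0 ((hP.const_mul _).const_mul _)
            (hJ _) fun r hr => ?_
          have hexp : Real.exp (-2 * β * t) ≤ Real.exp (-2 * β * r) :=
            Real.exp_le_exp.2 (by nlinarith [hr.2])
          have hlow := le_integral_G_sq ⟨hr.1, hr.2.le.trans ht.2⟩ hx
          have := Real.rpow_nonneg hr.1.le (-(1 / 2))
          gcongr
  · refine intervalIntegral.integral_mono_on ht0 (hJ _) (hJ _) fun r hr => ?_
    have hexp : Real.exp (-2 * β * r) ≤ Real.exp (2 * β * r) :=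
      Real.exp_le_exp.2 (by nlinarith [mul_nonneg hβ hr.1])
    have := hJ0 r
    gcongr
  · calc _ ≤ ∫ r in (0 : ℝ)..t, Real.exp (2 * β * t) * σ ^ 2 *
            (2 * S ^ 2 / √π * r ^ (-(1 / 2) : ℝ)) := by
          refine intervalIntegral.integral_mono_on_of_le_Ioo ht0 (hJ _)
            ((hP.const_mul _).const_mul _) fun r hr => ?_
          have hexp : Real.exp (2 * β * r) ≤ Real.exp (2 * β * t) :=
            Real.exp_le_exp.2 (by nlinarith [hr.2])
          have hup := integral_G_sq_le ⟨hr.1, hr.2.le.trans ht.2⟩ hx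
          have := hJ0 r
          gcongr
      _ = _ := by
          rw [intervalIntegral.integral_const_mul, intervalIntegral.integral_const_mul,
            integral_rpow_neg_half]
          ring
end

section
/- Let u₀ : [0,1] → ℝ be continuous. Then for every x ∈ [0,1], one has lim_{t→0⁺} ∫₀¹ G_t(x,y) u₀(y) dy = u₀(x). -/
open MeasureTheory Real Filter

/-- Unfolding of the integral over the line along the group generated by `y ↦ -y` and
`y ↦ y + 2`, which has `[0,1]` as a fundamental domain. -/
theorem hasSum_integral_unit_interval_reflections {F : ℝ → ℝ} (hF : Integrable F) :
    HasSum (fun n : ℤ => ∫ y in (0:ℝ)..1, (F (2 * n + y) + F (2 * n - y))) (∫ z, F z) := by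
  have h := ((hF.comp_mul_left' (two_ne_zero' ℝ)).hasSum_intervalIntegral (-(1 / 2))).mul_left 2
  rw [Measure.integral_comp_mul_left, smul_eq_mul, abs_of_pos (by norm_num),
    mul_inv_cancel_left₀ two_ne_zero] at h
  refine h.congr_fun fun n => ?_
  rw [intervalIntegral.mul_integral_comp_mul_left,
    intervalIntegral.integral_add
      ((hF.comp_add_left _).intervalIntegrable) ((hF.comp_sub_left _).intervalIntegrable),
    intervalIntegral.integral_comp_add_left, intervalIntegral.integral_comp_sub_left,
    add_comm, sub_zero, add_zero, intervalIntegral.integral_add_adjacent_intervals hF.intervalIntegrable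
      hF.intervalIntegrable]
  congr 1 <;> ring

theorem integral_tsum_unit_interval_reflections {F : ℝ → ℝ} (hF : Integrable F) :
    ∫ y in (0:ℝ)..1, ∑' n : ℤ, (F (2 * n + y) + F (2 * n - y)) = ∫ z, F z := by
  have hint (H : ℝ → ℝ) (hH : Integrable H) (n : ℤ) :
      IntervalIntegrable (fun y => H (2 * n + y) + H (2 * n - y)) volume 0 1 :=
    ((hH.comp_add_left _).add (hH.comp_sub_left _)).intervalIntegrable
  rw [← (hasSum_integral_unit_interval_reflections hF).tsum_eq]
  simp only [intervalIntegral.integral_of_le zero_le_one]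
  refine (integral_tsum_of_summable_integral_norm (fun n => (hint F hF n).1) ?_).symm
  have hs := (hasSum_integral_unit_interval_reflections hF.norm).summable
  simp only [intervalIntegral.integral_of_le zero_le_one] at hs
  exact hs.of_nonneg_of_le (fun n => integral_nonneg fun _ => norm_nonneg _)
    fun n => integral_mono (hint F hF n).1.norm (hint _ hF.norm n).1 fun _ => norm_add_le _ _

/-- The even, `2`-periodic extension of the restriction of `u` to `[0,1]`. -/
noncomputable def evenPeriodicExtension (u : ℝ → ℝ) (z : ℝ) : ℝ :=
  u (arccos (cos (π * z)) / π)

theorem arccos_div_pi_mem_Icc (z : ℝ) : arccos z / π ∈ Set.Icc (0 : ℝ) 1 :=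
  ⟨div_nonneg (arccos_nonneg _) pi_nonneg, div_le_one_of_le₀ (arccos_le_pi _) pi_nonneg⟩

theorem continuous_evenPeriodicExtension {u : ℝ → ℝ} (hu : ContinuousOn u (Set.Icc 0 1)) :
    Continuous (evenPeriodicExtension u) :=
  hu.comp_continuous (by fun_prop) fun _ => arccos_div_pi_mem_Icc _

theorem exists_norm_evenPeriodicExtension_le {u : ℝ → ℝ} (hu : ContinuousOn u (Set.Icc 0 1)) :
    ∃ C, ∀ z, ‖evenPeriodicExtension u z‖ ≤ C :=
  let ⟨C, hC⟩ := isCompact_Icc.exists_bound_of_continuousOn hu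
  ⟨C, fun _ => hC _ (arccos_div_pi_mem_Icc _)⟩

theorem evenPeriodicExtension_of_mem {u : ℝ → ℝ} {y : ℝ} (hy : y ∈ Set.Icc (0 : ℝ) 1) :
    evenPeriodicExtension u y = u y := by
  rw [evenPeriodicExtension, arccos_cos (mul_nonneg pi_nonneg hy.1)
    (mul_le_of_le_one_right pi_nonneg hy.2), mul_div_cancel_left₀ _ pi_ne_zero]

theorem evenPeriodicExtension_two_mul_add (u : ℝ → ℝ) (n : ℤ) (y : ℝ) :
    evenPeriodicExtension u (2 * n + y) = evenPeriodicExtension u y := by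
  rw [evenPeriodicExtension, evenPeriodicExtension, ← cos_add_int_mul_two_pi (π * y) n]
  ring_nf

theorem evenPeriodicExtension_two_mul_sub (u : ℝ → ℝ) (n : ℤ) (y : ℝ) :
    evenPeriodicExtension u (2 * n - y) = evenPeriodicExtension u y := by
  rw [evenPeriodicExtension, evenPeriodicExtension, ← cos_int_mul_two_pi_sub (π * y) n]
  ring_nf

/-- The Neumann heat evolution on `[0,1]` is the heat evolution on the line of the even
`2`-periodic extension, written with the standard Gaussian variable. -/
theorem integral_G_mul_eq {u : ℝ → ℝ} (hu : ContinuousOn u (Set.Icc 0 1)) (x : ℝ) {t : ℝ}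
    (ht : 0 < t) :
    ∫ y in (0:ℝ)..1, G t x y * u y =
      (√π)⁻¹ * ∫ w, exp (-1 * w ^ 2) * evenPeriodicExtension u (x + √(4 * t) * w) := by
  set U := evenPeriodicExtension u
  have h4t : 0 < 4 * t := by positivity
  have hsq : √(4 * t) ≠ 0 := (Real.sqrt_pos.2 h4t).ne'
  set F : ℝ → ℝ := fun z => exp (-(x - z) ^ 2 / (4 * t)) * U z with hFdef
  have hF : Integrable F := by
    obtain ⟨C, hC⟩ := exists_norm_evenPeriodicExtension_le hu
    refine Integrable.mul_bdd (c := C) ?_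
      (continuous_evenPeriodicExtension hu).aestronglyMeasurable (.of_forall hC)
    refine ((integrable_exp_neg_mul_sq (inv_pos.2 h4t)).comp_sub_left x).congr
      (.of_forall fun z => ?_)
    simp only
    congr 1
    ring
  have hGF : ∀ y ∈ Set.uIcc (0:ℝ) 1, G t x y * u y =
      1 / √(4 * π * t) * ∑' n : ℤ, (F (2 * n + y) + F (2 * n - y)) := fun y hy => by
    rw [Set.uIcc_of_le zero_le_one] at hy
    rw [G, mul_assoc, ← tsum_mul_right]
    congr 2
    ext n
    simp only [hFdef, U, evenPeriodicExtension_two_mul_add, evenPeriodicExtension_two_mul_sub,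
      evenPeriodicExtension_of_mem hy]
    rw [add_mul]
    congr 4 <;> ring
  rw [intervalIntegral.integral_congr hGF, intervalIntegral.integral_const_mul,
    integral_tsum_unit_interval_reflections hF]
  have hscale : ∫ w, F (x + √(4 * t) * w) = (√(4 * t))⁻¹ * ∫ z, F z := by
    rw [Measure.integral_comp_mul_left (fun w => F (x + w)), integral_add_left_eq_self F x,
      abs_of_nonneg (by positivity), smul_eq_mul]
  have hFw : ∀ w, F (x + √(4 * t) * w) = exp (-1 * w ^ 2) * U (x + √(4 * t) * w) := fun w => by
    simp only [hFdef]
    congr 2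
    rw [sub_add_cancel_left, neg_sq, mul_pow, Real.sq_sqrt h4t.le]
    field_simp
  simp only [← hFw]
  rw [hscale, ← mul_assoc, show 4 * π * t = π * (4 * t) by ring, Real.sqrt_mul pi_nonneg,
    one_div, mul_inv]

/-- For continuous `u₀ : [0,1] → ℝ` and every `x ∈ [0,1]`,
`lim_{t→0⁺} ∫₀¹ G_t(x,y) u₀(y) dy = u₀(x)`. -/
theorem green_semigroup_continuity_at_zero (u₀ : ℝ → ℝ)
    (hu₀ : ContinuousOn u₀ (Set.Icc 0 1)) (x : ℝ) (hx : x ∈ Set.Icc (0:ℝ) 1) :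
    Tendsto (fun t : ℝ => ∫ y in (0:ℝ)..1, G t x y * u₀ y)
      (nhdsWithin 0 (Set.Ioi 0)) (nhds (u₀ x)) := by
  set U := evenPeriodicExtension u₀
  have hU : Continuous U := continuous_evenPeriodicExtension hu₀
  obtain ⟨C, hC⟩ := exists_norm_evenPeriodicExtension_le hu₀
  have hlim : Tendsto (fun t : ℝ => ∫ w, exp (-1 * w ^ 2) * U (x + √(4 * t) * w))
      (nhdsWithin 0 (Set.Ioi 0)) (nhds (∫ w, exp (-1 * w ^ 2) * U x)) := by
    refine tendsto_integral_filter_of_dominated_convergence (fun w => exp (-1 * w ^ 2) * C)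
      (.of_forall fun t => by fun_prop) (.of_forall fun t => .of_forall fun w => ?_)
      ((integrable_exp_neg_mul_sq one_pos).mul_const C) (.of_forall fun w => ?_)
    · rw [norm_mul, norm_of_nonneg (exp_nonneg _)]
      gcongr
      exact hC _
    · have hc : Continuous fun t : ℝ => exp (-1 * w ^ 2) * U (x + √(4 * t) * w) := by fun_prop
      simpa using (hc.tendsto 0).mono_left nhdsWithin_le_nhds
  have hval : (√π)⁻¹ * ∫ w, exp (-1 * w ^ 2) * U x = u₀ x := by
    rw [integral_mul_const, integral_gaussian, div_one,
      inv_mul_cancel_left₀ (Real.sqrt_pos.2 pi_pos).ne']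
    exact evenPeriodicExtension_of_mem hx
  rw [← hval]
  refine (hlim.const_mul _).congr' ?_
  filter_upwards [self_mem_nhdsWithin] with t ht
  exact (integral_G_mul_eq hu₀ x ht).symm
end
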